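/- For every finite simple graph G = (V,E), the maximum size of an independent set of Sub_G equals the maximum size of an independent set of G plus the number of edges of G, i.e., α(Sub_G) = α(G) + |E|. -/

import Mathlib

/-- The 3-subdivision `Sub_G` of `G`: every edge `uv` is replaced by a path
`u – (e,u) – (e,v) – v` through two new vertices associated to that edge. -/
def SubG {α : Type*} (G : SimpleGraph α) :
    SimpleGraph (α ⊕ {p : G.edgeSet × α // p.2 ∈ (p.1 : Sym2 α)}) :=
  SimpleGraph.fromRel (fun a b =>
    match a, b with
    | Sum.inl u, Sum.inr q => q.1.2 = u
    | Sum.inr q, Sum.inr q' => q.1.1 = q'.1.1 ∧ q.1.2 ≠ q'.1.2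
    | _, _ => False)

/-- The independence (stability) number of a graph: the maximum size of a set of pairwise
non-adjacent vertices. -/
noncomputable def indepNum {β : Type*} (G : SimpleGraph β) : ℕ :=
  sSup {n : ℕ | ∃ s : Set β, (∀ a ∈ s, ∀ b ∈ s, ¬G.Adj a b) ∧ s.ncard = n}

theorem SubG_adj_inl_inr {α : Type*} (G : SimpleGraph α) (u : α)
    (q : {p : G.edgeSet × α // p.2 ∈ (p.1 : Sym2 α)}) :
    (SubG G).Adj (Sum.inl u) (Sum.inr q) ↔ q.1.2 = u := by
  simp [SubG]

theorem SubG_not_adj_inl_inl {α : Type*} (G : SimpleGraph α) (u v : α) :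
    ¬(SubG G).Adj (Sum.inl u) (Sum.inl v) := by
  simp [SubG]

theorem SubG_adj_inr_inr {α : Type*} (G : SimpleGraph α)
    (q r : {p : G.edgeSet × α // p.2 ∈ (p.1 : Sym2 α)}) :
    (SubG G).Adj (Sum.inr q) (Sum.inr r) ↔ q.1.1 = r.1.1 ∧ q.1.2 ≠ r.1.2 := by
  simp only [SubG, SimpleGraph.fromRel_adj]
  grind

theorem ncard_le_indepNum {β : Type*} [Finite β] {G : SimpleGraph β} {s : Set β}
    (hs : ∀ a ∈ s, ∀ b ∈ s, ¬G.Adj a b) : s.ncard ≤ indepNum G := by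
  refine le_csSup ⟨Nat.card β, ?_⟩ ⟨s, hs, rfl⟩
  rintro _ ⟨t, -, rfl⟩
  exact Set.ncard_le_card t

theorem exists_ncard_eq_indepNum {β : Type*} [Finite β] (G : SimpleGraph β) :
    ∃ s : Set β, (∀ a ∈ s, ∀ b ∈ s, ¬G.Adj a b) ∧ s.ncard = indepNum G := by
  refine Nat.sSup_mem (s := {n : ℕ | ∃ s : Set β, (∀ a ∈ s, ∀ b ∈ s, ¬G.Adj a b) ∧ s.ncard = n})
    ⟨0, ∅, by simp⟩ ⟨Nat.card β, ?_⟩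
  rintro _ ⟨t, -, rfl⟩
  exact Set.ncard_le_card t

theorem ncard_inl_image_union_inr_image {β γ : Type*} [Finite β] [Finite γ]
    (s : Set β) (t : Set γ) :
    (Sum.inl '' s ∪ Sum.inr '' t).ncard = s.ncard + t.ncard := by
  rw [Set.ncard_union_eq ?_ (Set.toFinite _) (Set.toFinite _),
    Set.ncard_image_of_injective _ Sum.inl_injective,
    Set.ncard_image_of_injective _ Sum.inr_injective]
  rw [Set.disjoint_left]
  rintro _ ⟨a, -, rfl⟩ ⟨b, -, h⟩
  cases h

/-- An independent set of `G` extends by one subdivision vertex per edge, chosen next to an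
endpoint outside the set. -/
theorem indepNum_add_ncard_edgeSet_le {α : Type*} [Finite α] (G : SimpleGraph α) :
    indepNum G + G.edgeSet.ncard ≤ indepNum (SubG G) := by
  obtain ⟨s, hs, hcard⟩ := exists_ncard_eq_indepNum G
  have hex : ∀ e : G.edgeSet, ∃ w, w ∈ (e : Sym2 α) ∧ w ∉ s := by
    rintro ⟨e, he⟩
    induction e with
    | h a b =>
      by_cases ha : a ∈ s
      · exact ⟨b, by simp, fun hb => hs a ha b hb he⟩
      · exact ⟨a, by simp, ha⟩
  choose w hw hws using hex
  let f : G.edgeSet → {p : G.edgeSet × α // p.2 ∈ (p.1 : Sym2 α)} := fun e => ⟨(e, w e), hw e⟩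
  have hf : Function.Injective f := fun e e' h => congrArg (fun q => q.1.1) h
  have hrange : (Set.range f).ncard = G.edgeSet.ncard := by
    rw [← Set.image_univ, Set.ncard_image_of_injective _ hf, Set.ncard_univ,
      Nat.card_coe_set_eq]
  rw [← hcard, ← hrange, ← ncard_inl_image_union_inr_image]
  apply ncard_le_indepNum
  rintro _ (⟨a, ha, rfl⟩ | ⟨_, ⟨e, rfl⟩, rfl⟩) _ (⟨b, hb, rfl⟩ | ⟨_, ⟨e', rfl⟩, rfl⟩)
  · exact SubG_not_adj_inl_inl G a b
  · rw [SubG_adj_inl_inr]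
    rintro rfl
    exact hws e' ha
  · rw [SimpleGraph.adj_comm, SubG_adj_inl_inr]
    rintro rfl
    exact hws e hb
  · rw [SubG_adj_inr_inr]
    rintro ⟨h, hne⟩
    exact hne (congrArg w h)

/-- An independent set of `SubG G` uses at most one subdivision vertex per edge, and none on an
edge with both endpoints in the set; deleting an endpoint of each edge not used leaves an
independent set of `G`. -/
theorem indepNum_SubG_le {α : Type*} [Finite α] (G : SimpleGraph α) :
    indepNum (SubG G) ≤ indepNum G + G.edgeSet.ncard := by
  obtain ⟨t, ht, hcard⟩ := exists_ncard_eq_indepNum (SubG G)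
  let A : Set α := Sum.inl ⁻¹' t
  let P : Set {p : G.edgeSet × α // p.2 ∈ (p.1 : Sym2 α)} := Sum.inr ⁻¹' t
  let F : Set G.edgeSet := (fun q => q.1.1) '' P
  let D : Set α := (fun e : G.edgeSet => (e : Sym2 α).out.1) '' Fᶜ
  have htcard : t.ncard = A.ncard + P.ncard := by
    rw [← ncard_inl_image_union_inr_image, Set.image_preimage_inl_union_image_preimage_inr]
  have hF : F.ncard = P.ncard := by
    refine Set.InjOn.ncard_image fun q hq r hr h => ?_
    have hqr := ht _ hq _ hr
    rw [SubG_adj_inr_inr] at hqr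
    exact Subtype.ext (Prod.ext h (not_not.mp fun hne => hqr ⟨h, hne⟩))
  have hE : F.ncard + Fᶜ.ncard = G.edgeSet.ncard := by
    rw [Set.ncard_add_ncard_compl, Nat.card_coe_set_eq]
  have hD : D.ncard ≤ Fᶜ.ncard := Set.ncard_image_le (Set.toFinite _)
  have hA : A.ncard ≤ (A \ D).ncard + D.ncard :=
    Set.ncard_le_ncard_sdiff_add_ncard A D (Set.toFinite _)
  have hind : (A \ D).ncard ≤ indepNum G := by
    apply ncard_le_indepNum
    rintro a ⟨ha, haD⟩ b ⟨hb, hbD⟩ hab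
    let e : G.edgeSet := ⟨s(a, b), hab⟩
    have heF : e ∉ F := by
      rintro ⟨q, hq, hqe⟩
      have hmem : q.1.2 ∈ s(a, b) := by
        have := q.2
        rwa [show q.1.1 = e from hqe] at this
      have hqA : q.1.2 ∈ A := by
        rcases Sym2.mem_iff.mp hmem with h | h <;> rw [h] <;> assumption
      exact ht _ hqA _ hq ((SubG_adj_inl_inr G _ _).mpr rfl)
    have hout : (e : Sym2 α).out.1 ∈ D := ⟨e, heF, rfl⟩
    rcases Sym2.mem_iff.mp (Sym2.out_fst_mem (e : Sym2 α)) with h | h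
    · exact haD (h ▸ hout)
    · exact hbD (h ▸ hout)
  omega

/-- `α(Sub_G) = α(G) + |E(G)|`. -/
theorem stmt9 {α : Type*} [Fintype α] [DecidableEq α] (G : SimpleGraph α) [DecidableRel G.Adj] :
    indepNum (SubG G) = indepNum G + G.edgeSet.ncard :=
  le_antisymm (indepNum_SubG_le G) (indepNum_add_ncard_edgeSet_le G)
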